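/- A proper morphism of schemes which is quasi-finite is finite. -/

import Mathlib

open AlgebraicGeometry

/-- A proper morphism of schemes which is quasi-finite (of finite type with finite fibers)
is finite. -/
theorem stmt_12 (X Y : Scheme) (f : X ⟶ Y)
    (hproper : IsProper f)
    (hft : LocallyOfFiniteType f)
    (hqc : QuasiCompact f)
    (hfib : ∀ y : Y, (f.base ⁻¹' {y}).Finite) :
    IsFinite f := by
  have : LocallyQuasiFinite f := .of_finite_preimage_singleton f hfib
  exact .of_isProper_of_locallyQuasiFinite f
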